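/- arXiv:1309.2231 — 5 statements merged into one kernel-verified Lean document; each statement's English description precedes it below -/
import Mathlib

section
/- Let G be a finite non-abelian group. Then C_G(g) = ⟨g⟩ for every non-central element g of G if and only if G is isomorphic to the quaternion group Q₈, or G is a non-abelian group of order pq where p and q are primes with q ≡ 1 (mod p). -/
section SelfCentralizing

open Subgroup
open scoped commutatorElement

variable {G : Type*} [Group G]

theorem mem_zpowers_of_commute
    (hC : ∀ g : G, g ∉ center G → centralizer {g} = zpowers g)
    {g x : G} (hg : g ∉ center G) (h : Commute g x) : x ∈ zpowers g := by
  rw [← hC g hg, mem_centralizer_singleton_iff]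
  exact h.eq.symm

theorem center_le_zpowers
    (hC : ∀ g : G, g ∉ center G → centralizer {g} = zpowers g)
    {g : G} (hg : g ∉ center G) : center G ≤ zpowers g := fun _ hz ↦
  mem_zpowers_of_commute hC hg (mem_center_iff.mp hz g)

theorem pow_mem_center_of_prime_dvd_orderOf [Finite G]
    (hC : ∀ g : G, g ∉ center G → centralizer {g} = zpowers g)
    {g : G} {r : ℕ} (hr : r.Prime) (h : r ∣ orderOf g) : g ^ r ∈ center G := by
  by_contra hgr
  have hmem : g ∈ zpowers (g ^ r) := mem_zpowers_of_commute hC hgr (Commute.pow_self g r)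
  have hdvd := orderOf_dvd_of_mem_zpowers hmem
  rw [orderOf_pow_of_dvd hr.ne_zero h] at hdvd
  have hle := Nat.le_of_dvd (Nat.div_pos (Nat.le_of_dvd (orderOf_pos g) h) hr.pos) hdvd
  exact absurd (Nat.div_lt_self (orderOf_pos g) hr.one_lt) hle.not_gt

theorem mem_of_zpow_mem_of_isCoprime {H : Subgroup G} {g : G} {m n : ℤ} (h : IsCoprime m n)
    (hm : g ^ m ∈ H) (hn : g ^ n ∈ H) : g ∈ H := by
  obtain ⟨a, b, hab⟩ := h
  have key : g = (g ^ m) ^ a * (g ^ n) ^ b := by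
    rw [← zpow_mul, ← zpow_mul, ← zpow_add, mul_comm m, mul_comm n, hab, zpow_one]
  rw [key]
  exact mul_mem (zpow_mem hm a) (zpow_mem hn b)

theorem isZGroup_of_center_eq_bot [Finite G]
    (hC : ∀ g : G, g ∉ center G → centralizer {g} = zpowers g) (hZ : center G = ⊥) :
    IsZGroup G := by
  refine ⟨fun p hp P ↦ ?_⟩
  have := Fact.mk hp
  rcases subsingleton_or_nontrivial P with hP | hP
  · infer_instance
  have := P.2.center_nontrivial
  obtain ⟨z, hz⟩ := exists_ne (1 : center P)
  have hz' : (z : G) ∉ center G := by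
    rw [hZ, mem_bot]
    simpa using hz
  refine Subgroup.isCyclic_of_le (H' := zpowers (z : G)) fun x hx ↦ ?_
  refine mem_zpowers_of_commute hC hz' ?_
  have := mem_center_iff.mp z.2 ⟨x, hx⟩
  exact (congrArg Subtype.val this).symm

theorem card_eq_mul_of_center_eq_bot [Finite G] (hG : ¬ ∀ a b : G, a * b = b * a)
    (hC : ∀ g : G, g ∉ center G → centralizer {g} = zpowers g) (hZ : center G = ⊥) :
    ∃ p q : ℕ, p.Prime ∧ q.Prime ∧ q ≡ 1 [MOD p] ∧ Nat.card G = p * q := by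
  have hne {g : G} (hg : g ≠ 1) : g ∉ center G := by rwa [hZ, mem_bot]
  have hprime {g : G} (hg : g ≠ 1) : (orderOf g).Prime := by
    obtain ⟨r, hr, hdvd⟩ := Nat.exists_prime_and_dvd (mt orderOf_eq_one_iff.mp hg)
    have h := pow_mem_center_of_prime_dvd_orderOf hC hr hdvd
    rw [hZ, mem_bot] at h
    have := Fact.mk hr
    rwa [orderOf_eq_prime h hg]
  have := isZGroup_of_center_eq_bot hC hZ
  have : Nontrivial G := by
    by_contra h
    rw [not_nontrivial_iff_subsingleton] at h
    exact hG fun a b ↦ Subsingleton.elim _ _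
  obtain ⟨g, hgz⟩ := (Subgroup.isCyclic_iff_exists_zpowers_eq_top (commutator G)).mp
    (IsZGroup.isCyclic_commutator G)
  have hg1 : g ≠ 1 := by
    intro h
    rw [h, zpowers_one_eq_bot] at hgz
    refine hG fun a b ↦ ?_
    have hab : ⁅a, b⁆ ∈ commutator G :=
      commutator_mem_commutator (mem_top a) (mem_top b)
    rw [← hgz, mem_bot] at hab
    exact commutatorElement_eq_one_iff_mul_comm.mp hab
  have hcard : Nat.card (commutator G) = orderOf g := by
    rw [← hgz, Nat.card_zpowers]
  have hcyc : IsCyclic (G ⧸ commutator G) := IsZGroup.isCyclic_abelianization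
  obtain ⟨t, ht⟩ := hcyc.exists_generator
  obtain ⟨h, rfl⟩ := QuotientGroup.mk_surjective t
  have hh : h ∉ commutator G := by
    intro hmem
    refine (IsZGroup.commutator_lt (G := G)).ne (eq_top_iff.mpr fun x _ ↦ ?_)
    have hx := ht (QuotientGroup.mk x)
    rw [(QuotientGroup.eq_one_iff h).mpr hmem, zpowers_one_eq_bot, mem_bot] at hx
    exact (QuotientGroup.eq_one_iff x).mp hx
  have hh1 : h ≠ 1 := fun h1 ↦ hh (h1 ▸ one_mem _)
  have hp := hprime hh1
  have hindex : Nat.card (G ⧸ commutator G) = orderOf h := by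
    have htop : orderOf (QuotientGroup.mk h : G ⧸ commutator G) = Nat.card (G ⧸ commutator G) :=
      orderOf_eq_card_of_forall_mem_zpowers ht
    have hdvd : orderOf (QuotientGroup.mk h : G ⧸ commutator G) ∣ orderOf h :=
      orderOf_map_dvd (QuotientGroup.mk' (commutator G)) h
    rw [← htop]
    refine (hp.eq_one_or_self_of_dvd _ hdvd).resolve_left fun h1 ↦ hh ?_
    exact (QuotientGroup.eq_one_iff h).mp (orderOf_eq_one_iff.mp h1)
  refine ⟨orderOf h, orderOf g, hp, hprime hg1, ?_, ?_⟩
  · have := Fact.mk hp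
    have hpg : IsPGroup (orderOf h) (zpowers (ConjAct.toConjAct h)) := by
      refine IsPGroup.of_card (n := 1) ?_
      rw [Nat.card_zpowers, pow_one]
      exact orderOf_injective ConjAct.toConjAct.toMonoidHom ConjAct.toConjAct.injective h
    have hmod := hpg.card_modEq_card_fixedPoints (commutator G)
    rw [hcard] at hmod
    suffices hfix : MulAction.fixedPoints (zpowers (ConjAct.toConjAct h)) (commutator G) = {1} by
      simpa [hfix] using hmod
    ext z
    simp only [MulAction.mem_fixedPoints, Set.mem_singleton_iff]
    constructor
    · intro hz
      by_contra hz1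
      have hfixed := congrArg Subtype.val (hz ⟨ConjAct.toConjAct h, mem_zpowers _⟩)
      change h * (z : G) * h⁻¹ = z at hfixed
      have hcomm : Commute (z : G) h := (mul_inv_eq_iff_eq_mul.mp hfixed).symm
      have hmem := mem_zpowers_of_commute hC (hne (by simpa using hz1)) hcomm
      exact hh ((zpowers_le.mpr z.2) hmem)
    · rintro rfl s
      exact smul_one s
  · rw [card_eq_card_quotient_mul_card_subgroup (commutator G), hindex, hcard]

theorem exists_prime_isPGroup_of_center_ne_bot [Finite G]
    (hG : ¬ ∀ a b : G, a * b = b * a)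
    (hC : ∀ g : G, g ∉ center G → centralizer {g} = zpowers g) (hZ : center G ≠ ⊥) :
    ∃ r : ℕ, r.Prime ∧ IsPGroup r G ∧ ∀ g : G, g ^ r ∈ center G := by
  obtain ⟨r, hr, hrZ⟩ := Nat.exists_prime_and_dvd
    (mt (center G).eq_bot_of_card_eq hZ)
  have hpow (g : G) : g ^ r ∈ center G := by
    by_cases hg : g ∈ center G
    · exact pow_mem hg r
    · refine pow_mem_center_of_prime_dvd_orderOf hC hr (hrZ.trans ?_)
      rw [← Nat.card_zpowers]
      exact card_dvd_of_le (center_le_zpowers hC hg)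
  have hord {g : G} (hg : g ∉ center G) : ∃ k : ℕ, g ^ r ^ k = 1 := by
    refine ⟨_, (Nat.eq_prime_pow_of_unique_prime_dvd (p := r) (orderOf_pos g).ne' ?_) ▸
      pow_orderOf_eq_one g⟩
    intro s hs hsg
    by_contra hsr
    refine hg (mem_of_zpow_mem_of_isCoprime (m := (s : ℤ)) (n := (r : ℤ))
      (Nat.isCoprime_iff_coprime.mpr ((Nat.coprime_primes hs hr).mpr hsr)) ?_ ?_)
    · simpa using pow_mem_center_of_prime_dvd_orderOf hC hs hsg
    · simpa using hpow g
  refine ⟨r, hr, fun g ↦ ?_, hpow⟩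
  by_cases hg : g ∈ center G
  · obtain ⟨x, hx⟩ : ∃ x : G, x ∉ center G := by
      by_contra! h
      exact hG fun a b ↦ mem_center_iff.mp (h b) a
    obtain ⟨k, hk⟩ := hord hx
    obtain ⟨m, rfl⟩ := mem_zpowers_iff.mp (center_le_zpowers hC hx hg)
    refine ⟨k, ?_⟩
    rw [← zpow_natCast, zpow_comm, zpow_natCast, hk, one_zpow]
  · exact hord hg

theorem center_le_zpowers_pow
    (hC : ∀ g : G, g ∉ center G → centralizer {g} = zpowers g)
    {r : ℕ} (hr : r.Prime) (hpow : ∀ g : G, g ^ r ∈ center G) {g : G} (hg : g ∉ center G) :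
    center G ≤ zpowers (g ^ r) := by
  intro z hz
  obtain ⟨k, rfl⟩ := mem_zpowers_iff.mp (center_le_zpowers hC hg hz)
  by_cases hk : (r : ℤ) ∣ k
  · obtain ⟨m, rfl⟩ := hk
    exact mem_zpowers_iff.mpr ⟨m, by rw [← zpow_natCast, zpow_mul]⟩
  · refine absurd (mem_of_zpow_mem_of_isCoprime
      ((Nat.prime_iff_prime_int.mp hr).coprime_iff_not_dvd.mpr hk) ?_ hz) hg
    simpa using hpow g

theorem exists_notMem_center_commutator_mem_center [Finite G]
    (hG : ¬ ∀ a b : G, a * b = b * a) {r : ℕ} [Fact r.Prime] (hP : IsPGroup r G) :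
    ∃ x : G, x ∉ center G ∧ ∀ y : G, ⁅x, y⁆ ∈ center G := by
  have : Nontrivial (G ⧸ center G) := by
    rw [QuotientGroup.nontrivial_iff]
    exact fun h ↦ hG fun a b ↦ mem_center_iff.mp (h ▸ mem_top b) a
  have := (hP.to_quotient (center G)).center_nontrivial
  obtain ⟨⟨t, ht⟩, ht1⟩ := exists_ne (1 : center (G ⧸ center G))
  obtain ⟨x, rfl⟩ := QuotientGroup.mk_surjective t
  refine ⟨x, fun hx ↦ ht1 (Subtype.ext ((QuotientGroup.eq_one_iff x).mpr hx)), fun y ↦ ?_⟩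
  rw [← QuotientGroup.eq_one_iff]
  change ⁅(x : G ⧸ center G), (y : G ⧸ center G)⁆ = 1
  exact commutatorElement_eq_one_iff_mul_comm.mpr (mem_center_iff.mp ht y).symm

/-- The power of a product of two elements whose commutator is central. -/
theorem mul_pow_of_mul_eq_central {u y d : G} (hd : d ∈ center G) (h : u * y = d * (y * u))
    (n : ℕ) : (y * u) ^ n = d ^ n.choose 2 * (y ^ n * u ^ n) := by
  have hdc (g : G) : g * d = d * g := mem_center_iff.mp hd g
  have hdk (k : ℕ) (g : G) : Commute g (d ^ k) := (show Commute g d from hdc g).pow_right k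
  have hu (n : ℕ) : u ^ n * y = d ^ n * (y * u ^ n) := by
    induction n with
    | zero => simp
    | succ n ih =>
      calc u ^ (n + 1) * y = u ^ n * (u * y) := by rw [pow_succ, mul_assoc]
        _ = d * (u ^ n * y) * u := by rw [h, ← mul_assoc, hdc]; simp only [mul_assoc]
        _ = d ^ (n + 1) * (y * u ^ (n + 1)) := by
          rw [ih, pow_succ' d, pow_succ u]; simp only [mul_assoc]
  induction n with
  | zero => simp
  | succ n ih =>
    calc (y * u) ^ (n + 1) = d ^ n.choose 2 * (y ^ n * (u ^ n * y) * u) := by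
          rw [pow_succ, ih]; simp only [mul_assoc]
      _ = d ^ n.choose 2 * (y ^ n * d ^ n * (y * u ^ n) * u) := by
          rw [hu]; simp only [mul_assoc]
      _ = d ^ (n + 1).choose 2 * (y ^ (n + 1) * u ^ (n + 1)) := by
          rw [(hdk n (y ^ n)).eq, Nat.choose_succ_succ' n 1, Nat.choose_one_right, add_comm n,
            pow_add, pow_succ y, pow_succ u]
          simp only [mul_assoc]

/-- If the center is nontrivial, then it has order two and every noncentral element squares to
its generator; moreover the second center is strictly larger than the center. -/
theorem exists_sq_eq_of_center_ne_bot [Finite G] (hG : ¬ ∀ a b : G, a * b = b * a)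
    (hC : ∀ g : G, g ∉ center G → centralizer {g} = zpowers g) (hZ : center G ≠ ⊥) :
    ∃ z : G, z ≠ 1 ∧ (∀ g : G, g ∈ center G ↔ g = 1 ∨ g = z) ∧
      (∀ g : G, g ∉ center G → g ^ 2 = z) ∧
      ∃ x : G, x ∉ center G ∧ ∀ y : G, ⁅x, y⁆ ∈ center G := by
  obtain ⟨r, hr, hP, hpow⟩ := exists_prime_isPGroup_of_center_ne_bot hG hC hZ
  have := Fact.mk hr
  obtain ⟨x, hx, hxc⟩ := exists_notMem_center_commutator_mem_center hG hP
  obtain ⟨y, hxy⟩ : ∃ y : G, ¬ Commute x y := by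
    by_contra! h
    exact hx (mem_center_iff.mpr fun g ↦ (h g).symm.eq)
  have hpow_ne {g : G} (hg : g ∉ center G) : g ^ r ≠ 1 := fun h ↦
    hZ (le_bot_iff.mp (by simpa [h] using center_le_zpowers_pow hC hr hpow hg))
  obtain ⟨k, hk⟩ := mem_zpowers_iff.mp (center_le_zpowers_pow hC hr hpow hx (hpow y))
  set u := x ^ (-k) with hu
  have hyu : y ^ r * u ^ r = 1 := by
    rw [← hk, hu, ← zpow_natCast, ← zpow_natCast, ← zpow_mul, ← zpow_mul, ← zpow_add]
    rw [show (r : ℤ) * k + -k * r = 0 by ring, zpow_zero]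
  have hw : y * u ∉ center G := by
    intro h
    have h1 : Commute x (y * u) := mem_center_iff.mp h x
    have h2 : Commute x u := (Commute.refl x).zpow_right _
    exact hxy (by simpa using h1.mul_right h2.inv_right)
  obtain ⟨d, hd, hdu⟩ : ∃ d ∈ center G, u * y = d * (y * u) := by
    refine ⟨⁅u, y⁆, ?_, by simp [commutatorElement_def, mul_assoc]⟩
    rw [← QuotientGroup.eq_one_iff]
    change ⁅(u : G ⧸ center G), (y : G ⧸ center G)⁆ = 1
    have hcomm : Commute (x : G ⧸ center G) (y : G ⧸ center G) :=
      commutatorElement_eq_one_iff_commute.mp ((QuotientGroup.eq_one_iff _).mpr (hxc y))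
    exact commutatorElement_eq_one_iff_commute.mpr (hcomm.zpow_left (-k))
  have hdr : d ^ r = 1 := by
    have h1 : u ^ r * y = y * u ^ r := (mem_center_iff.mp (hpow u) y).symm
    have h2 : y * u * y⁻¹ = d⁻¹ * u := by
      rw [mul_inv_eq_iff_eq_mul, mul_assoc, hdu, inv_mul_cancel_left]
    have h3 : y * u ^ r * y⁻¹ = (d⁻¹ * u) ^ r := by rw [← h2, conj_pow]
    have h4 : Commute d⁻¹ u := (show Commute u d from mem_center_iff.mp hd u).symm.inv_left
    rw [← h1, mul_inv_cancel_right, h4.mul_pow, inv_pow] at h3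
    simpa using h3.symm
  have hwr : (y * u) ^ r = d ^ r.choose 2 := by
    rw [mul_pow_of_mul_eq_central hd hdu, hyu, mul_one]
  have hr2 : r = 2 := by
    by_contra hne
    obtain ⟨m, hm⟩ := hr.dvd_choose_self two_ne_zero (hr.two_le.lt_of_ne' hne)
    exact hpow_ne hw (by rw [hwr, hm, pow_mul, hdr, one_pow])
  subst hr2
  rw [Nat.choose_self, pow_one] at hwr
  have hd1 : d ≠ 1 := hwr ▸ hpow_ne hw
  have hcenter (g : G) : g ∈ center G ↔ g = 1 ∨ g = d := by
    constructor
    · intro hg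
      obtain ⟨m, rfl⟩ := mem_zpowers_iff.mp (hwr ▸ center_le_zpowers_pow hC hr hpow hw hg)
      rcases m.even_or_odd' with ⟨n, rfl | rfl⟩
      · left; rw [zpow_mul, zpow_ofNat, hdr, one_zpow]
      · right; rw [zpow_add, zpow_mul, zpow_ofNat, hdr, one_zpow, one_mul, zpow_one]
    · rintro (rfl | rfl)
      exacts [one_mem _, hd]
  exact ⟨d, hd1, hcenter, fun g hg ↦ ((hcenter _).mp (hpow g)).resolve_left (hpow_ne hg),
    x, hx, hxc⟩

/-- The homomorphism from the generalized quaternion group defined by a pair of elements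
satisfying its relations. -/
def QuaternionGroup.lift {n : ℕ} (x y : G) (hx : x ^ (2 * n) = 1) (hy : y ^ 2 = x ^ n)
    (hxy : x * y = y * x⁻¹) : QuaternionGroup n →* G :=
  MonoidHom.mk'
    (fun
      | .a i => x ^ (i.cast : ℤ)
      | .xa i => y * x ^ (i.cast : ℤ))
    (by
      have hcast {i : ZMod (2 * n)} {m : ℤ} (h : (m : ZMod (2 * n)) = i) :
          x ^ (i.cast : ℤ) = x ^ m := by
        rw [← orderOf_dvd_iff_pow_eq_one] at hx
        rw [zpow_eq_zpow_iff_modEq]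
        refine Int.ModEq.of_dvd (Int.natCast_dvd_natCast.mpr hx) ?_
        rw [← ZMod.intCast_eq_intCast_iff, h, ZMod.intCast_zmod_cast]
      have hconj (m : ℤ) : x ^ m * y = y * x ^ (-m) := by
        have h : SemiconjBy y x⁻¹ x := hxy.symm
        simpa using (h.zpow_right m).eq.symm
      rintro (i | i) (j | j)
      · rw [QuaternionGroup.a_mul_a]
        dsimp only
        rw [← zpow_add]
        exact hcast (by simp)
      · rw [QuaternionGroup.a_mul_xa]
        dsimp only
        rw [← mul_assoc, hconj, mul_assoc, ← zpow_add, mul_right_inj]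
        exact hcast (by simp; ring)
      · rw [QuaternionGroup.xa_mul_a]
        dsimp only
        rw [mul_assoc, ← zpow_add, mul_right_inj]
        exact hcast (by simp)
      · rw [QuaternionGroup.xa_mul_xa]
        dsimp only
        rw [mul_assoc, ← mul_assoc _ y, hconj, mul_assoc, ← mul_assoc y y, ← sq, hy,
          ← zpow_add, ← zpow_natCast, ← zpow_add]
        exact hcast (by simp; ring))

theorem nonempty_mulEquiv_quaternionGroup [Finite G] (hG : ¬ ∀ a b : G, a * b = b * a)
    (hC : ∀ g : G, g ∉ center G → centralizer {g} = zpowers g) (hZ : center G ≠ ⊥) :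
    Nonempty (G ≃* QuaternionGroup 2) := by
  obtain ⟨z, hz1, hcenter, hsq, x, hx, hxc⟩ := exists_sq_eq_of_center_ne_bot hG hC hZ
  obtain ⟨y, hxy⟩ : ∃ y : G, ¬ Commute x y := by
    by_contra! h
    exact hx (mem_center_iff.mpr fun g ↦ (h g).symm.eq)
  have hy : y ∉ center G := fun h ↦ hxy (mem_center_iff.mp h x)
  have hz : z ∈ center G := (hcenter z).mpr (Or.inr rfl)
  have hzz : z * z = 1 :=
    ((hcenter _).mp (mul_mem hz hz)).resolve_right fun h ↦ hz1 (by simpa using h)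
  have hcomm {g : G} (hg : ¬ Commute x g) : x * g = z * (g * x) := by
    have h : ⁅x, g⁆ = z := ((hcenter _).mp (hxc g)).resolve_left
      fun h ↦ hg (commutatorElement_eq_one_iff_commute.mp h)
    rw [← h]
    simp [commutatorElement_def, mul_assoc]
  have hx4 : x ^ (2 * 2) = 1 := by rw [pow_mul, hsq x hx, sq, hzz]
  have hord : orderOf x = 2 ^ (1 + 1) :=
    orderOf_eq_prime_pow (by rwa [pow_one, hsq x hx]) hx4
  have hrel : x * y = y * x⁻¹ := by
    have hinv : x⁻¹ = z * x := by
      rw [inv_eq_iff_mul_eq_one, ← mul_assoc, mem_center_iff.mp hz x, mul_assoc, ← sq, hsq x hx,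
        hzz]
    rw [hcomm hxy, hinv, ← mul_assoc, ← mul_assoc, mem_center_iff.mp hz y]
  let f : QuaternionGroup 2 →* G :=
    QuaternionGroup.lift x y hx4 ((hsq y hy).trans (hsq x hx).symm) hrel
  have hfa (i : ZMod (2 * 2)) : f (.a i) = x ^ (i.cast : ℤ) := rfl
  have hfxa (i : ZMod (2 * 2)) : f (.xa i) = y * x ^ (i.cast : ℤ) := rfl
  have hcast (m : ℤ) : x ^ (((m : ZMod (2 * 2)).cast : ℤ)) = x ^ m := by
    rw [zpow_eq_zpow_iff_modEq, hord]
    exact (ZMod.intCast_eq_intCast_iff _ _ (2 * 2)).mp (ZMod.intCast_zmod_cast _)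
  have hinj : Function.Injective f := by
    rw [injective_iff_map_eq_one]
    rintro (i | i) hi
    · rw [hfa, ← orderOf_dvd_iff_zpow_eq_one, hord] at hi
      rw [← QuaternionGroup.a_zero, ← ZMod.intCast_zmod_cast i]
      exact congrArg _ ((ZMod.intCast_zmod_eq_zero_iff_dvd _ (2 * 2)).mpr hi)
    · rw [hfxa] at hi
      rw [eq_inv_of_mul_eq_one_left hi] at hxy
      exact absurd ((Commute.refl x).zpow_right _).inv_right hxy
  have hsurj : Function.Surjective f := by
    intro g
    by_cases hg : Commute x g
    · obtain ⟨m, rfl⟩ := mem_zpowers_iff.mp (mem_zpowers_of_commute hC hx hg)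
      exact ⟨.a m, by rw [hfa, hcast]⟩
    · have h : Commute x (y⁻¹ * g) := by
        have hyx : y * x = z⁻¹ * (x * y) := by rw [hcomm hxy, inv_mul_cancel_left]
        rw [commute_iff_eq, ← mul_right_inj y]
        calc y * (x * (y⁻¹ * g)) = y * x * y⁻¹ * g := by simp only [mul_assoc]
          _ = z⁻¹ * (x * g) := by rw [hyx]; simp only [mul_assoc, mul_inv_cancel_left]
          _ = y * (y⁻¹ * g * x) := by
            rw [hcomm hg, inv_mul_cancel_left, mul_assoc, mul_inv_cancel_left]
      obtain ⟨m, hm⟩ := mem_zpowers_iff.mp (mem_zpowers_of_commute hC hx h)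
      exact ⟨.xa m, by rw [hfxa, hcast, hm, mul_inv_cancel_left]⟩
  exact ⟨(MulEquiv.ofBijective f ⟨hinj, hsurj⟩).symm⟩

theorem QuaternionGroup.centralizer_eq_zpowers {g : QuaternionGroup 2}
    (hg : g ∉ center (QuaternionGroup 2)) : centralizer {g} = zpowers g := by
  have key : ∀ g h : QuaternionGroup 2, h * g = g * h →
      (∀ k : QuaternionGroup 2, k * g = g * k) ∨ ∃ i : Fin 4, g ^ (i : ℕ) = h := by decide
  refine le_antisymm (fun h hh ↦ ?_) ?_
  · obtain hc | ⟨i, rfl⟩ := key g h (mem_centralizer_singleton_iff.mp hh)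
    · exact absurd (mem_center_iff.mpr hc) hg
    · exact npow_mem_zpowers g i
  · rw [zpowers_le, mem_centralizer_singleton_iff]

theorem centralizer_eq_zpowers_of_mulEquiv {H : Type*} [Group H] (e : G ≃* H)
    (hH : ∀ h : H, h ∉ center H → centralizer {h} = zpowers h) {g : G} (hg : g ∉ center G) :
    centralizer {g} = zpowers g := by
  have heg : e g ∉ center H := fun h ↦ hg <| mem_center_iff.mpr fun k ↦ e.injective <| by
    rw [map_mul, map_mul, mem_center_iff.mp h]
  refine le_antisymm (fun x hx ↦ ?_) ?_
  · have hcomm : Commute (e g) (e x) :=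
      Commute.map (mem_centralizer_singleton_iff.mp hx).symm e
    obtain ⟨m, hm⟩ := mem_zpowers_iff.mp (mem_zpowers_of_commute hH heg hcomm)
    exact mem_zpowers_iff.mpr ⟨m, e.injective (by rw [map_zpow, hm])⟩
  · rw [zpowers_le, mem_centralizer_singleton_iff]

theorem centralizer_eq_zpowers_of_card_eq_mul {p q : ℕ} (hp : p.Prime) (hq : q.Prime)
    (hcard : Nat.card G = p * q) {g : G} (hg : g ∉ center G) :
    centralizer {g} = zpowers g := by
  have hfin : Finite G := Nat.finite_of_card_ne_zero (hcard ▸ mul_ne_zero hp.ne_zero hq.ne_zero)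
  have hmem : g ∈ centralizer {g} := mem_centralizer_singleton_iff.mpr rfl
  have hle : zpowers g ≤ centralizer {g} := zpowers_le.mpr hmem
  have hdvd := hcard ▸ (centralizer {g}).card_subgroup_dvd_card
  have hne_one : Nat.card (centralizer {g}) ≠ 1 := fun h ↦ hg <| by
    rw [card_eq_one.mp h, mem_bot] at hmem
    exact hmem ▸ one_mem _
  have hne_top : Nat.card (centralizer {g}) ≠ p * q := fun h ↦ hg <| by
    rw [← hcard, card_eq_iff_eq_top] at h
    exact mem_center_iff.mpr fun k ↦ mem_centralizer_singleton_iff.mp (h ▸ mem_top k)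
  have hprime : (Nat.card (centralizer {g})).Prime := by
    obtain ⟨a, b, ha, hb, hab⟩ := (Nat.dvd_mul).mp hdvd
    rw [← hab] at hne_one hne_top ⊢
    clear hab hdvd
    rcases (Nat.dvd_prime hp).mp ha with rfl | rfl <;>
      rcases (Nat.dvd_prime hq).mp hb with rfl | rfl <;> simp_all
  refine (eq_of_le_of_card_ge hle ?_).symm
  have hd := card_dvd_of_le hle
  rcases (Nat.dvd_prime hprime).mp hd with h | h
  · rw [card_eq_one, zpowers_eq_bot] at h
    exact absurd (h ▸ one_mem _) hg
  · exact h.ge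

end SelfCentralizing

/-- A finite non-abelian group satisfies `C_G(g) = ⟨g⟩` for every
non-central `g` iff it is isomorphic to `Q₈` or it is non-abelian of order `pq`
with `p`, `q` primes and `q ≡ 1 (mod p)`. -/
theorem centralizer_eq_zpowers_iff
    {G : Type*} [Group G] [Finite G] (hG : ¬ ∀ a b : G, a * b = b * a) :
    (∀ g : G, g ∉ Subgroup.center G → Subgroup.centralizer {g} = Subgroup.zpowers g) ↔
      (Nonempty (G ≃* QuaternionGroup 2) ∨
        ∃ p q : ℕ, p.Prime ∧ q.Prime ∧ q ≡ 1 [MOD p] ∧ Nat.card G = p * q) := by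
  constructor
  · intro hC
    by_cases hZ : Subgroup.center G = ⊥
    · exact Or.inr (card_eq_mul_of_center_eq_bot hG hC hZ)
    · exact Or.inl (nonempty_mulEquiv_quaternionGroup hG hC hZ)
  · rintro (⟨⟨e⟩⟩ | ⟨p, q, hp, hq, -, hcard⟩) g hg
    · exact centralizer_eq_zpowers_of_mulEquiv e
        (fun _ ↦ QuaternionGroup.centralizer_eq_zpowers) hg
    · exact centralizer_eq_zpowers_of_card_eq_mul hp hq hcard hg
end

section
/- Let G be a non-abelian finite group and let H be a non-abelian subgroup of G. If p is a prime divisor of |H| which is a bad prime for mci in G, then p is also a bad prime for mci in H. -/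
/-- A prime `p` is a *bad prime for mci* in the finite group `G` if `p` divides `|G|`,
a Sylow `p`-subgroup `P` of `G` has order `p`, and `C_G(P) = P·Z(G)`. -/
def IsBadPrimeForMci (p : ℕ) (G : Type*) [Group G] : Prop :=
  p.Prime ∧ p ∣ Nat.card G ∧
    ∃ P : Sylow p G, Nat.card (P : Subgroup G) = p ∧
      Subgroup.centralizer ((P : Subgroup G) : Set G) =
        (P : Subgroup G) ⊔ Subgroup.center G

/-- The inclusion `C_G(P) ≤ P·Z(G)` passes from one Sylow `p`-subgroup to all of them. -/
theorem Sylow.centralizer_le_sup_center_of_centralizer_le {G : Type*} [Group G] [Finite G]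
    {p : ℕ} [Fact p.Prime] {P : Sylow p G} (Q : Sylow p G)
    (hP : Subgroup.centralizer ((P : Subgroup G) : Set G) ≤
      (P : Subgroup G) ⊔ Subgroup.center G) :
    Subgroup.centralizer ((Q : Subgroup G) : Set G) ≤
      (Q : Subgroup G) ⊔ Subgroup.center G := by
  obtain ⟨g, rfl⟩ := MulAction.exists_smul_eq G P Q
  intro x hx
  have hconj : g⁻¹ * x * g ∈ Subgroup.centralizer ((P : Subgroup G) : Set G) := by
    rw [Subgroup.mem_centralizer_iff] at hx ⊢
    intro y hy
    have hcomm := hx (g * y * g⁻¹) (Subgroup.smul_mem_pointwise_smul y (MulAut.conj g) _ hy)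
    calc y * (g⁻¹ * x * g) = g⁻¹ * (g * y * g⁻¹ * x) * g := by group
      _ = g⁻¹ * x * g * y := by rw [hcomm]; group
  obtain ⟨y, hy, z, hz, hyz⟩ := Subgroup.mem_sup_of_normal_right.mp (hP hconj)
  refine Subgroup.mem_sup_of_normal_right.mpr ⟨g * y * g⁻¹,
    Subgroup.smul_mem_pointwise_smul y (MulAut.conj g) _ hy, z, hz, ?_⟩
  have hzg := Subgroup.mem_center_iff.mp hz g⁻¹
  calc g * y * g⁻¹ * z = g * (y * z) * g⁻¹ := by rw [mul_assoc, hzg]; group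
    _ = x := by rw [hyz]; group

/-- If `H` is a non-abelian subgroup of a non-abelian finite group `G`
and `p` is a prime divisor of `|H|` which is a bad prime for mci in `G`, then `p` is
also a bad prime for mci in `H`. -/
theorem isBadPrimeForMci_subgroup
    {G : Type*} [Group G] [Finite G]
    (hna : ¬ ∀ a b : G, a * b = b * a)
    (H : Subgroup G) (hH : ¬ ∀ a b : H, a * b = b * a)
    {p : ℕ} (hpH : p ∣ Nat.card H)
    (hbad : IsBadPrimeForMci p G) :
    IsBadPrimeForMci p H := by
  obtain ⟨hp, -, P, hPcard, hPcent⟩ := hbad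
  have : Fact p.Prime := ⟨hp⟩
  obtain ⟨Q⟩ := (inferInstance : Nonempty (Sylow p H))
  obtain ⟨R, hQR⟩ := (Q.isPGroup'.map H.subtype).exists_le_sylow
  have hRcard : Nat.card (R : Subgroup G) = p :=
    (Nat.card_congr (R.equiv P).toEquiv).trans hPcard
  have hQmap : Nat.card ((Q : Subgroup H).map H.subtype) = Nat.card (Q : Subgroup H) :=
    Subgroup.card_map_of_injective H.subtype_injective
  have hQcard : Nat.card (Q : Subgroup H) = p := by
    refine Nat.dvd_antisymm ?_ (Q.dvd_card_of_dvd_card hpH)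
    rw [← hQmap]
    exact (Subgroup.card_dvd_of_le hQR).trans hRcard.dvd
  have hQR_eq : (Q : Subgroup H).map H.subtype = R :=
    Subgroup.eq_of_le_of_card_ge hQR (by rw [hQmap, hQcard, hRcard])
  refine ⟨hp, hpH, Q, hQcard, le_antisymm ?_ (sup_le ?_ (Subgroup.center_le_centralizer _))⟩
  · intro x hx
    have hxR : (x : G) ∈ Subgroup.centralizer ((R : Subgroup G) : Set G) := by
      rw [← hQR_eq, Subgroup.mem_centralizer_iff]
      rintro _ ⟨y, hy, rfl⟩
      exact congrArg Subtype.val (Subgroup.mem_centralizer_iff.mp hx y hy)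
    obtain ⟨r, hr, z, hz, hrz⟩ := Subgroup.mem_sup_of_normal_right.mp
      (Sylow.centralizer_le_sup_center_of_centralizer_le R hPcent.le hxR)
    rw [← hQR_eq] at hr
    obtain ⟨y, hy, rfl⟩ := hr
    refine Subgroup.mem_sup_of_normal_right.mpr ⟨y, hy, y⁻¹ * x, ?_, mul_inv_cancel_left y x⟩
    have hz_eq : ((y⁻¹ * x : H) : G) = z := by
      simp [← hrz]
    rw [Subgroup.mem_center_iff]
    intro h
    apply Subtype.ext
    rw [H.coe_mul h, H.coe_mul _ h, hz_eq]
    exact Subgroup.mem_center_iff.mp hz h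
  · have := isCyclic_of_prime_card hQcard
    intro x hx
    rw [Subgroup.mem_centralizer_iff]
    intro y hy
    exact congrArg Subtype.val
      (IsCyclic.commGroup.mul_comm (⟨y, hy⟩ : (Q : Subgroup H)) ⟨x, hx⟩)
end

section
/- Let G be a non-abelian finite group and let p be a bad prime for mci in G. Then any Sylow p-subgroup of G/Z(G) is self-centralizing, i.e., it equals its own centralizer in G/Z(G). -/
open scoped Pointwise in
/-- Centralizers commute with the pointwise action of automorphisms. -/
theorem Subgroup.centralizer_mulAut_smul {G : Type*} [Group G] (a : MulAut G) (H : Subgroup G) :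
    centralizer ((a • H : Subgroup G) : Set G) = a • centralizer (H : Set G) := by
  ext x
  rw [mem_pointwise_smul_iff_inv_smul_mem, mem_centralizer_iff, mem_centralizer_iff]
  constructor
  · intro h y hy
    have := congrArg (a⁻¹ • ·) (h (a • y) (smul_mem_pointwise_smul y a H hy))
    simpa [smul_mul'] using this
  · intro h y hy
    have := congrArg (a • ·) (h (a⁻¹ • y) (mem_pointwise_smul_iff_inv_smul_mem.mp hy))
    simpa [smul_mul'] using this

/-- If a Sylow `p`-subgroup of order `p` is not central, then the center has no element of
order `p`. -/
theorem Sylow.eq_one_of_mem_center_of_pow_eq_one {G : Type*} [Group G] {p : ℕ} [Fact p.Prime]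
    (P : Sylow p G) (hP : Nat.card (P : Subgroup G) = p)
    (hPZ : ¬ (P : Subgroup G) ≤ Subgroup.center G) {z : G} (hz : z ∈ Subgroup.center G)
    (hzp : z ^ p = 1) : z = 1 := by
  by_contra hz1
  have hzZ : Subgroup.zpowers z ≤ Subgroup.center G := Subgroup.zpowers_le.mpr hz
  have hcard : Nat.card (Subgroup.zpowers z) = p := by
    rw [Nat.card_zpowers, orderOf_eq_prime hzp hz1]
  have : (Subgroup.zpowers z).Normal :=
    ⟨fun n hn g => by rwa [Subgroup.mem_center_iff.mp (hzZ hn) g, mul_inv_cancel_right]⟩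
  have hle : Subgroup.zpowers z ≤ P :=
    (IsPGroup.of_card (n := 1) (by rw [hcard, pow_one])).le_sylow_of_normal P
  have : Finite (P : Subgroup G) :=
    Nat.finite_of_card_ne_zero (hP.trans_ne (Fact.out : p.Prime).ne_zero)
  exact hPZ ((Subgroup.eq_of_le_of_card_ge hle (hP.trans hcard.symm).le).symm.trans_le hzZ)

/-- If a noncentral Sylow `p`-subgroup `P` of order `p` satisfies `C_G(P) = P·Z(G)`, then its image
in `G/Z(G)` is self-centralizing. -/
theorem Sylow.centralizer_map_mk_center {G : Type*} [Group G] {p : ℕ} [Fact p.Prime]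
    (P : Sylow p G) (hP : Nat.card (P : Subgroup G) = p)
    (hPZ : ¬ (P : Subgroup G) ≤ Subgroup.center G)
    (hC : Subgroup.centralizer ((P : Subgroup G) : Set G) =
      (P : Subgroup G) ⊔ Subgroup.center G) :
    Subgroup.centralizer
        (((P : Subgroup G).map (QuotientGroup.mk' (Subgroup.center G)) :
          Subgroup (G ⧸ Subgroup.center G)) : Set (G ⧸ Subgroup.center G)) =
      (P : Subgroup G).map (QuotientGroup.mk' (Subgroup.center G)) := by
  apply le_antisymm
  · intro y hy
    obtain ⟨x, rfl⟩ := QuotientGroup.mk'_surjective _ y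
    have hx : x ∈ Subgroup.centralizer ((P : Subgroup G) : Set G) := by
      rw [Subgroup.mem_centralizer_iff]
      intro u hu
      have hcomm := Subgroup.mem_centralizer_iff.mp hy _ (Subgroup.mem_map_of_mem _ hu)
      rw [← map_mul, ← map_mul, QuotientGroup.mk'_apply, QuotientGroup.mk'_apply,
        QuotientGroup.eq] at hcomm
      have hup : u ^ p = 1 := by
        rw [← orderOf_dvd_iff_pow_eq_one, ← hP]
        exact Subgroup.orderOf_dvd_natCard _ hu
      have hz : Commute (x⁻¹ * u * x) ((u * x)⁻¹ * (x * u)) :=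
        Subgroup.mem_center_iff.mp hcomm _
      have hzp : ((u * x)⁻¹ * (x * u)) ^ p = 1 := by
        have h := hz.mul_pow p
        have hu' : x⁻¹ * u * x * ((u * x)⁻¹ * (x * u)) = u := by group
        have hx' : (x⁻¹ * u * x) ^ p = 1 := by
          have := conj_pow (i := p) (a := x⁻¹) (b := u)
          rw [inv_inv] at this
          rw [this, hup]
          group
        rw [hu', hup, hx', one_mul] at h
        exact h.symm
      exact inv_mul_eq_one.mp (P.eq_one_of_mem_center_of_pow_eq_one hP hPZ hcomm hzp)
    rw [hC] at hx
    have := Subgroup.mem_map_of_mem (QuotientGroup.mk' (Subgroup.center G)) hx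
    rwa [Subgroup.map_sup, (Subgroup.map_eq_bot_iff _).mpr
      (QuotientGroup.ker_mk' _).ge, sup_bot_eq] at this
  · have h : (P : Subgroup G) ≤ Subgroup.centralizer ((P : Subgroup G) : Set G) :=
      hC ▸ le_sup_left
    exact (Subgroup.map_mono h).trans (Subgroup.map_centralizer_le_centralizer_image _ _)

/-- If `p` is a bad prime for mci in a non-abelian finite group `G`,
then every Sylow `p`-subgroup of `G/Z(G)` is self-centralizing. -/
theorem sylow_quotient_center_self_centralizing
    {G : Type*} [Group G] [Finite G]
    (hna : ¬ ∀ a b : G, a * b = b * a)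
    {p : ℕ} (hbad : IsBadPrimeForMci p G)
    (Q : Sylow p (G ⧸ Subgroup.center G)) :
    Subgroup.centralizer ((Q : Subgroup (G ⧸ Subgroup.center G)) : Set (G ⧸ Subgroup.center G)) =
      (Q : Subgroup (G ⧸ Subgroup.center G)) := by
  obtain ⟨hp, -, P, hP, hC⟩ := hbad
  have : Fact p.Prime := ⟨hp⟩
  have hPZ : ¬ (P : Subgroup G) ≤ Subgroup.center G := by
    intro h
    have htop : Subgroup.center G = ⊤ := by
      rw [← sup_eq_right.mpr h, ← hC, Subgroup.centralizer_eq_top_iff_subset]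
      exact h
    exact hna fun a b => (Subgroup.mem_center_iff.mp (htop ▸ Subgroup.mem_top b) a)
  obtain ⟨g, rfl⟩ := MulAction.exists_smul_eq (G ⧸ Subgroup.center G)
    (P.mapSurjective (QuotientGroup.mk'_surjective (Subgroup.center G))) Q
  rw [Sylow.coe_subgroup_smul, Subgroup.centralizer_mulAut_smul, Sylow.coe_mapSurjective,
    P.centralizer_map_mk_center hP hPZ hC]
end

section
/- Let G be a non-abelian finite group and let p be a bad prime for mci in G. Then G/Z(G) is non-abelian and p is a bad prime for mci in G/Z(G). -/
open Subgroup in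
/-- A central element whose `p`-th power is trivial lies in every Sylow `p`-subgroup. -/
theorem Sylow.mem_of_mem_center_of_pow_eq_one {G : Type*} [Group G] {p : ℕ} (P : Sylow p G)
    {z : G} (hz : z ∈ center G) (hzp : z ^ p = 1) : z ∈ P := by
  have hnormal : (zpowers z).Normal :=
    ⟨fun n hn g ↦ by
      have hn' : n ∈ center G := (zpowers_le.mpr hz) hn
      rwa [mem_center_iff.mp hn' g, mul_inv_cancel_right]⟩
  have hpz : IsPGroup p (zpowers z) := by
    rintro ⟨_, k, rfl⟩
    refine ⟨1, Subtype.ext ?_⟩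
    change (z ^ k) ^ (p ^ 1) = 1
    rw [pow_one, ← zpow_natCast, zpow_comm, zpow_natCast, hzp, one_zpow]
  exact hpz.le_sylow_of_normal P (mem_zpowers z)

/-- If the commutator of `x` with `g` is central, `x ^ p = 1`, and the center has no `p`-torsion,
then `x` and `g` commute. -/
theorem mul_comm_of_quotient_center_mul_comm {G : Type*} [Group G] {p : ℕ}
    (htors : ∀ z ∈ Subgroup.center G, z ^ p = 1 → z = 1) {x g : G} (hx : x ^ p = 1)
    (h : (x : G ⧸ Subgroup.center G) * g = g * x) : x * g = g * x := by
  have hz : g * x * g⁻¹ * x⁻¹ ∈ Subgroup.center G := by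
    rw [← QuotientGroup.eq_one_iff]
    simp only [QuotientGroup.mk_mul, QuotientGroup.mk_inv]
    rw [← h, mul_inv_cancel_right, mul_inv_cancel]
  set z := g * x * g⁻¹ * x⁻¹ with hzdef
  have hconj : g * x * g⁻¹ = z * x := by simp [hzdef]
  have hcomm : Commute z x := (Subgroup.mem_center_iff.mp hz x).symm
  have hzp : z ^ p = 1 := by
    have hpow : (z * x) ^ p = 1 := by rw [← hconj, conj_pow, hx, mul_one, mul_inv_cancel]
    rwa [hcomm.mul_pow, hx, mul_one] at hpow
  rw [htors z hz hzp, one_mul, mul_inv_eq_iff_eq_mul] at hconj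
  exact hconj.symm

/-- If `p` is a bad prime for mci in a non-abelian finite group `G`,
then `G/Z(G)` is non-abelian and `p` is a bad prime for mci in `G/Z(G)`. -/
theorem isBadPrimeForMci_quotient_center
    {G : Type*} [Group G] [Finite G]
    (hna : ¬ ∀ a b : G, a * b = b * a)
    {p : ℕ} (hbad : IsBadPrimeForMci p G) :
    (¬ ∀ a b : G ⧸ Subgroup.center G, a * b = b * a) ∧
      IsBadPrimeForMci p (G ⧸ Subgroup.center G) := by
  obtain ⟨hp, -, P, hcard, hcent⟩ := hbad
  have : Fact p.Prime := ⟨hp⟩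
  have hnot : ¬ (P : Subgroup G) ≤ Subgroup.center G := by
    intro hle
    have htop : Subgroup.center G = ⊤ := by
      rw [← sup_eq_right.mpr hle, ← hcent, Subgroup.centralizer_eq_top_iff_subset]
      exact hle
    exact hna fun a b ↦ Subgroup.mem_center_iff.mp (htop ▸ Subgroup.mem_top b) a
  have hpow : ∀ x ∈ P, x ^ p = 1 := fun x hx ↦ by
    have hx' : (⟨x, hx⟩ : P) ^ Nat.card P = 1 := pow_card_eq_one'
    exact hcard ▸ congrArg Subtype.val hx'
  have hdisj : ∀ x ∈ P, x ∈ Subgroup.center G → x = 1 := by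
    intro x hx hxz
    by_contra hne
    apply hnot
    have hord : orderOf x = p := orderOf_eq_prime (hpow x hx) hne
    have hgen : Subgroup.zpowers x = P :=
      Subgroup.eq_of_le_of_card_ge (Subgroup.zpowers_le.mpr hx)
        (by rw [Nat.card_zpowers, hord, hcard])
    rw [← hgen]
    exact Subgroup.zpowers_le.mpr hxz
  have hcommute : ∀ x ∈ P, ∀ g : G,
      (x : G ⧸ Subgroup.center G) * g = g * x → x * g = g * x := fun x hx g ↦
    mul_comm_of_quotient_center_mul_comm
      (fun z hz hzp ↦ hdisj z (P.mem_of_mem_center_of_pow_eq_one hz hzp) hz) (hpow x hx)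
  refine ⟨fun hab ↦ hnot fun x hx ↦
    Subgroup.mem_center_iff.mpr fun g ↦ (hcommute x hx g (hab _ _)).symm, hp, ?_⟩
  let π := QuotientGroup.mk' (Subgroup.center G)
  let Q : Sylow p (G ⧸ Subgroup.center G) :=
    P.mapSurjective (QuotientGroup.mk'_surjective (Subgroup.center G))
  have hQcard : Nat.card (Q : Subgroup (G ⧸ Subgroup.center G)) = p := by
    refine Eq.trans (Nat.card_image_of_injOn fun x hx y hy hxy ↦ ?_) hcard
    exact inv_mul_eq_one.mp
      (hdisj _ (mul_mem (inv_mem hx) hy) (QuotientGroup.eq.mp hxy))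
  refine ⟨hQcard ▸ Subgroup.card_subgroup_dvd_card _, Q, hQcard, le_antisymm ?_ ?_⟩
  · intro q hq
    obtain ⟨g, rfl⟩ := QuotientGroup.mk'_surjective _ q
    have hg : g ∈ Subgroup.centralizer ((P : Subgroup G) : Set G) :=
      Subgroup.mem_centralizer_iff.mpr fun x hx ↦
        hcommute x hx g (Subgroup.mem_centralizer_iff.mp hq _ (Subgroup.mem_map_of_mem π hx))
    rw [hcent] at hg
    have hmap := Subgroup.mem_map_of_mem π hg
    rw [Subgroup.map_sup, QuotientGroup.map_mk'_self, sup_bot_eq] at hmap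
    exact Subgroup.mem_sup_left hmap
  · have : IsCyclic (Q : Subgroup (G ⧸ Subgroup.center G)) := isCyclic_of_prime_card hQcard
    exact sup_le (Subgroup.le_centralizer _) (Subgroup.center_le_centralizer _)
end

section
/- Let G be a non-abelian finite group with trivial center. Then a prime p is a bad prime for mci in G if and only if p divides |G| exactly to the first power (i.e., p divides |G| but p² does not) and G has no element of order pq for any prime q ≠ p. -/
/-- A Sylow `p`-subgroup has order `p` iff `p` divides the group order exactly once. -/
theorem Sylow.card_eq_prime_iff {G : Type*} [Group G] [Finite G] {p : ℕ} [hp : Fact p.Prime]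
    (P : Sylow p G) :
    Nat.card (P : Subgroup G) = p ↔ p ∣ Nat.card G ∧ ¬ p ^ 2 ∣ Nat.card G := by
  have hG : Nat.card G ≠ 0 := Nat.card_pos.ne'
  rw [P.card_eq_multiplicity, hp.out.pow_dvd_iff_le_factorization hG,
    hp.out.dvd_iff_one_le_factorization hG]
  conv_lhs => rhs; rw [← pow_one p]
  rw [Nat.pow_right_inj hp.out.two_le]
  omega

/-- Every `p`-element of a finite group has a conjugate in a given Sylow `p`-subgroup. -/
theorem Sylow.exists_conj_mem {G : Type*} [Group G] [Finite G] {p : ℕ} [Fact p.Prime]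
    (P : Sylow p G) {y : G} (hy : IsPGroup p (Subgroup.zpowers y)) :
    ∃ g : G, g * y * g⁻¹ ∈ P := by
  obtain ⟨Q, hQ⟩ := hy.exists_le_sylow
  obtain ⟨g, rfl⟩ := MulAction.exists_smul_eq G Q P
  exact ⟨g, Subgroup.smul_mem_pointwise_smul y (MulAut.conj g) (Q : Subgroup G)
    (hQ (Subgroup.mem_zpowers y))⟩

/-- If a Sylow `p`-subgroup of order `p` is self-centralizing, then there is no element of order
`p * q` with `1 < q`. -/
theorem Sylow.orderOf_ne_mul_of_centralizer_le {G : Type*} [Group G] [Finite G] {p q : ℕ}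
    [hp : Fact p.Prime] (P : Sylow p G) (hP : Nat.card (P : Subgroup G) = p)
    (hC : Subgroup.centralizer ((P : Subgroup G) : Set G) ≤ P) (hq : 1 < q) (x : G) :
    orderOf x ≠ p * q := by
  intro hx
  have hy : orderOf (x ^ q) = p := by
    rw [orderOf_pow_of_dvd (by omega) (hx ▸ dvd_mul_left q p), hx,
      Nat.mul_div_cancel _ (by omega)]
  obtain ⟨g, hg⟩ := P.exists_conj_mem (y := x ^ q)
    (IsPGroup.of_card (n := 1) (by rw [Nat.card_zpowers, hy, pow_one]))
  have hconj (z : G) : orderOf (g * z * g⁻¹) = orderOf z :=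
    orderOf_injective (MulAut.conj g).toMonoidHom (MulAut.conj g).injective z
  have hgen : Subgroup.zpowers (g * x ^ q * g⁻¹) = P :=
    Subgroup.eq_of_le_of_card_ge (Subgroup.zpowers_le.mpr hg)
      (by rw [Nat.card_zpowers, hconj, hy, hP])
  have hmem : g * x * g⁻¹ ∈ (P : Subgroup G) := by
    refine hC (Subgroup.mem_centralizer_iff.mpr fun z hz => ?_)
    rw [← hgen, ← conj_pow] at hz
    obtain ⟨k, rfl⟩ := Subgroup.mem_zpowers_iff.mp hz
    exact (((Commute.refl _).pow_left q).zpow_left k).eq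
  have hdvd := Subgroup.orderOf_dvd_natCard _ hmem
  rw [hconj, hx, hP] at hdvd
  nlinarith [Nat.le_of_dvd hp.out.pos hdvd, hp.out.pos]

/-- If a Sylow `p`-subgroup is nontrivial and there are no elements of order `p * q` for primes
`q ≠ p`, then it contains its own centralizer. -/
theorem Sylow.centralizer_le_of_forall_orderOf_ne {G : Type*} [Group G] [Finite G] {p : ℕ}
    [hp : Fact p.Prime] (P : Sylow p G) (hP : p ∣ Nat.card (P : Subgroup G))
    (h : ∀ q : ℕ, q.Prime → q ≠ p → ∀ x : G, orderOf x ≠ p * q) :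
    Subgroup.centralizer ((P : Subgroup G) : Set G) ≤ P := by
  intro x hx
  obtain ⟨y, hy⟩ := exists_prime_orderOf_dvd_card' (G := (P : Subgroup G)) p hP
  rw [← Subgroup.orderOf_coe] at hy
  have hpow : orderOf x = p ^ (orderOf x).primeFactorsList.length := by
    refine Nat.eq_prime_pow_of_unique_prime_dvd (orderOf_pos x).ne' fun {q} hq hqx => ?_
    by_contra hne
    have hz : orderOf (x ^ (orderOf x / q)) = q :=
      orderOf_pow_orderOf_div (orderOf_pos x).ne' hqx
    have hcomm : Commute (y : G) (x ^ (orderOf x / q)) :=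
      Commute.pow_right (Subgroup.mem_centralizer_iff.mp hx y y.2) _
    refine h q hq hne _ ((hcomm.orderOf_mul_eq_mul_orderOf_of_coprime ?_).trans ?_)
    · rw [hy, hz]
      exact (Nat.coprime_primes hp.out hq).mpr (Ne.symm hne)
    · rw [hy, hz]
  have hmem : x ∈ Subgroup.zpowers x ⊓ Subgroup.normalizer (P : Set G) :=
    ⟨Subgroup.mem_zpowers x, Subgroup.centralizer_le_normalizer _ hx⟩
  rw [(IsPGroup.of_card ((Nat.card_zpowers x).trans hpow)).inf_normalizer_sylow P] at hmem
  exact hmem.2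

/-- Let `G` be a non-abelian finite group with trivial center.
A prime `p` is a bad prime for mci in `G` iff `p` divides `|G|` exactly to the first
power and `G` has no element of order `pq` for any prime `q ≠ p`. -/
theorem isBadPrimeForMci_iff_of_center_eq_bot
    {G : Type*} [Group G] [Finite G]
    (hna : ¬ ∀ a b : G, a * b = b * a)
    (hZ : Subgroup.center G = ⊥)
    {p : ℕ} (hp : p.Prime) :
    IsBadPrimeForMci p G ↔
      (p ∣ Nat.card G ∧ ¬ p ^ 2 ∣ Nat.card G ∧
        ∀ q : ℕ, q.Prime → q ≠ p → ¬ ∃ x : G, orderOf x = p * q) := by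
  have : Fact p.Prime := ⟨hp⟩
  simp only [IsBadPrimeForMci, hZ, sup_bot_eq]
  constructor
  · rintro ⟨-, hdvd, P, hP, hC⟩
    exact ⟨hdvd, (P.card_eq_prime_iff.mp hP).2, fun q hq _ ⟨x, hx⟩ =>
      P.orderOf_ne_mul_of_centralizer_le hP hC.le hq.one_lt x hx⟩
  · rintro ⟨hdvd, hsq, h⟩
    obtain ⟨P⟩ : Nonempty (Sylow p G) := inferInstance
    have hP : Nat.card (P : Subgroup G) = p := P.card_eq_prime_iff.mpr ⟨hdvd, hsq⟩
    have : IsMulCommutative (P : Subgroup G) := (isCyclic_of_prime_card hP).isMulCommutative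
    exact ⟨hp, hdvd, P, hP, le_antisymm
      (P.centralizer_le_of_forall_orderOf_ne (dvd_of_eq hP.symm)
        fun q hq hne x hx => h q hq hne ⟨x, hx⟩)
      (Subgroup.le_centralizer _)⟩
end
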